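/- Let γ ∈ Γ with (γ,γ) ≠ 0. Then 2γ ∈ Φ, i.e. 2γ is an even root of g₀. -/

import Mathlib

/-- A finite-dimensional Lie superalgebra `g = g₀ ⊕ g₁`: a Lie algebra `g₀`,
a `g₀`-module `g₁` (action `act`), and a symmetric bracket `br : g₁ × g₁ → g₀`
satisfying invariance and the super Jacobi identity. -/
structure LieSuperData (k g0 g1 : Type*) [Field k] [LieRing g0] [LieAlgebra k g0]
    [AddCommGroup g1] [Module k g1] where
  act : g0 →ₗ[k] g1 →ₗ[k] g1
  act_lie : ∀ (x y : g0) (u : g1), act ⁅x, y⁆ u = act x (act y u) - act y (act x u)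
  br : g1 →ₗ[k] g1 →ₗ[k] g0
  br_symm : ∀ u v : g1, br u v = br v u
  br_invariance : ∀ (x : g0) (u v : g1), ⁅x, br u v⁆ = br (act x u) v + br u (act x v)
  super_jacobi : ∀ u v w : g1, act (br u v) w + act (br v w) u + act (br w u) v = 0

/-- A nondegenerate even supersymmetric invariant bilinear form `B = (B₀, B₁)` on a
Lie superalgebra. -/
structure InvForm {k g0 g1 : Type*} [Field k] [LieRing g0] [LieAlgebra k g0]
    [AddCommGroup g1] [Module k g1] (D : LieSuperData k g0 g1) where
  B0 : g0 →ₗ[k] g0 →ₗ[k] k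
  B1 : g1 →ₗ[k] g1 →ₗ[k] k
  B0_symm : ∀ x y : g0, B0 x y = B0 y x
  B0_invariant : ∀ x y z : g0, B0 ⁅x, y⁆ z = B0 x ⁅y, z⁆
  B1_alt : ∀ u v : g1, B1 u v = - B1 v u
  compat : ∀ (x : g0) (u v : g1), B0 x (D.br u v) = B1 (D.act x u) v
  B0_nondeg : ∀ x : g0, (∀ y : g0, B0 x y = 0) → x = 0
  B1_nondeg : ∀ u : g1, (∀ v : g1, B1 u v = 0) → u = 0

/-- The weight space `(g₀)_α = {x ∈ g₀ : ⁅H, x⁆ = α(H) x for all H ∈ t}`. -/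
def evenSpace {k g0 : Type*} [Field k] [LieRing g0] [LieAlgebra k g0]
    (t : LieSubalgebra k g0) (α : Module.Dual k t) : Submodule k g0 where
  carrier := {x | ∀ H : t, ⁅(H : g0), x⁆ = α H • x}
  add_mem' := by
    intro a b ha hb H
    rw [lie_add, ha H, hb H, smul_add]
  zero_mem' := by
    intro H
    rw [lie_zero, smul_zero]
  smul_mem' := by
    intro c x hx H
    rw [lie_smul, hx H, smul_comm]

/-- The weight space `(g₁)_γ = {u ∈ g₁ : H · u = γ(H) u for all H ∈ t}`. -/
def oddSpace {k g0 g1 : Type*} [Field k] [LieRing g0] [LieAlgebra k g0]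
    [AddCommGroup g1] [Module k g1] (D : LieSuperData k g0 g1)
    (t : LieSubalgebra k g0) (γ : Module.Dual k t) : Submodule k g1 where
  carrier := {u | ∀ H : t, D.act (H : g0) u = γ H • u}
  add_mem' := by
    intro a b ha hb H
    rw [map_add, ha H, hb H, smul_add]
  zero_mem' := by
    intro H
    rw [map_zero, smul_zero]
  smul_mem' := by
    intro c u hu H
    rw [map_smul, hu H, smul_comm]

/-- The induced form on weights: `(θ, η) := B₀(H_θ, H_η)`. -/
def pairing {k g0 : Type*} [Field k] [LieRing g0] [LieAlgebra k g0]
    {t : LieSubalgebra k g0} (B0 : g0 →ₗ[k] g0 →ₗ[k] k)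
    (Hd : Module.Dual k t → t) (θ η : Module.Dual k t) : k :=
  B0 (Hd θ : g0) (Hd η : g0)


open Pointwise

/-- The odd part `B₁` of an invariant form is invariant under the action of `g₀`. -/
theorem InvForm.B1_act {k g0 g1 : Type*} [Field k] [LieRing g0] [LieAlgebra k g0]
    [AddCommGroup g1] [Module k g1] {D : LieSuperData k g0 g1} (F : InvForm D)
    (x : g0) (u v : g1) : F.B1 (D.act x u) v = - F.B1 u (D.act x v) := by
  rw [← F.compat, D.br_symm, F.compat, F.B1_alt]

/-- Brackets of odd weight vectors are even weight vectors for the sum of the weights. -/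
theorem br_mem_evenSpace {k g0 g1 : Type*} [Field k] [LieRing g0] [LieAlgebra k g0]
    [AddCommGroup g1] [Module k g1] (D : LieSuperData k g0 g1) {t : LieSubalgebra k g0}
    {γ δ : Module.Dual k t} {u v : g1} (hu : u ∈ oddSpace D t γ) (hv : v ∈ oddSpace D t δ) :
    D.br u v ∈ evenSpace t (γ + δ) := by
  intro H
  rw [D.br_invariance, hu H, hv H, map_smul, map_smul, LinearMap.smul_apply,
    LinearMap.add_apply, add_smul]

/-- The zero weight space of a Cartan subalgebra is contained in the subalgebra. -/
theorem mem_of_mem_evenSpace_zero {k g0 : Type*} [Field k] [LieRing g0] [LieAlgebra k g0]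
    {t : LieSubalgebra k g0} (hC : t.IsCartanSubalgebra) {x : g0}
    (hx : x ∈ evenSpace t 0) : x ∈ t := by
  rw [← hC.self_normalizing, LieSubalgebra.mem_normalizer_iff']
  intro y hy
  have h : ⁅y, x⁆ = 0 := by simpa using hx ⟨y, hy⟩
  rw [h]
  exact t.zero_mem

/-- Odd weight spaces whose weights do not sum to zero are orthogonal. -/
theorem InvForm.add_eq_zero_of_B1_ne_zero {k g0 g1 : Type*} [Field k] [LieRing g0]
    [LieAlgebra k g0] [AddCommGroup g1] [Module k g1] {D : LieSuperData k g0 g1} (F : InvForm D)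
    {t : LieSubalgebra k g0} {γ δ : Module.Dual k t} {u v : g1}
    (hu : u ∈ oddSpace D t γ) (hv : v ∈ oddSpace D t δ) (h : F.B1 u v ≠ 0) : γ + δ = 0 := by
  ext H
  have hH := F.B1_act (H : g0) u v
  rw [hu H, hv H, map_smul, map_smul, LinearMap.smul_apply, smul_eq_mul, smul_eq_mul] at hH
  refine (mul_eq_zero.mp ?_).resolve_right h
  rw [LinearMap.add_apply, add_mul, hH, neg_add_cancel]

theorem stmt_8 {k g0 g1 : Type*} [Field k] [IsAlgClosed k] [CharZero k]
    [LieRing g0] [LieAlgebra k g0] [FiniteDimensional k g0]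
    [AddCommGroup g1] [Module k g1] [FiniteDimensional k g1]
    (D : LieSuperData k g0 g1)
    (hred : LieAlgebra.radical k g0 = LieAlgebra.center k g0)
    (t : LieSubalgebra k g0) (hC : t.IsCartanSubalgebra)
    (Φ Γ : Set (Module.Dual k t))
    (hΦ : ∀ α : Module.Dual k t, α ∈ Φ ↔ (α ≠ 0 ∧ evenSpace t α ≠ ⊥))
    (hΓ : ∀ γ : Module.Dual k t, γ ∈ Γ ↔ oddSpace D t γ ≠ ⊥)
    (hΓ0 : (0 : Module.Dual k t) ∉ Γ)
    (hdisj : Φ ∩ Γ = ∅)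
    (hg0 : t.toSubmodule ⊔ (⨆ α ∈ Φ, evenSpace t α) = ⊤)
    (hg1 : (⨆ γ ∈ Γ, oddSpace D t γ) = ⊤)
    (F : InvForm D)
    (Hd : Module.Dual k t → t)
    (hHd : ∀ (θ : Module.Dual k t) (H : t), θ H = F.B0 (Hd θ : g0) (H : g0))
    (γ : Module.Dual k t) (hγ : γ ∈ Γ) (hni : pairing F.B0 Hd γ γ ≠ 0) :
    (2 : k) • γ ∈ Φ := by
  have hγ0 : γ ≠ 0 := fun h => hΓ0 (h ▸ hγ)
  obtain ⟨u, hu, hu0⟩ := Submodule.exists_mem_ne_zero_of_ne_bot ((hΓ γ).mp hγ)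
  have hpair : ∃ δ : Module.Dual k t, ∃ v ∈ oddSpace D t δ, F.B1 u v ≠ 0 := by
    by_contra! hcon
    refine hu0 (F.B1_nondeg u fun v => ?_)
    have hle : (⨆ δ ∈ Γ, oddSpace D t δ) ≤ LinearMap.ker (F.B1 u) :=
      iSup₂_le fun δ _ w hw => hcon δ w hw
    exact hle (hg1 ▸ Submodule.mem_top)
  obtain ⟨δ, v, hv, huv⟩ := hpair
  have hsum : γ + δ = 0 := F.add_eq_zero_of_B1_ne_zero hu hv huv
  have hmem : D.br u v ∈ t :=
    mem_of_mem_evenSpace_zero hC (hsum ▸ br_mem_evenSpace D hu hv)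
  have hact : D.act (D.br u v) u = (pairing F.B0 Hd γ γ * F.B1 u v) • u := by
    have h := hu ⟨D.br u v, hmem⟩
    rwa [hHd, F.compat, hu (Hd γ), map_smul, LinearMap.smul_apply, smul_eq_mul, hHd] at h
  rw [hΦ]
  refine ⟨smul_ne_zero two_ne_zero hγ0, fun hbot => ?_⟩
  have huu : D.br u u = 0 := by
    have h := br_mem_evenSpace D hu hu
    rwa [← two_smul k γ, hbot, Submodule.mem_bot] at h
  have hJ := D.super_jacobi u u v
  rw [huu, D.br_symm v u, hact, map_zero, LinearMap.zero_apply, zero_add, ← two_smul k] at hJ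
  exact smul_ne_zero two_ne_zero (smul_ne_zero (mul_ne_zero hni huv) hu0) hJ
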